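/- arXiv:math/0702404 — 2 statements merged into one kernel-verified Lean document; each statement's English description precedes it below -/
import Mathlib

section
/- The vector-valued rational function Y₄(z) = Σ_{k=1}^{3} ℓ_k/(z − z_k) satisfies the KZ system with ρ = −1, i.e. Y₄'(z) = −A(z)·Y₄(z) for all z ∈ ℂ ∖ {z₁, z₂, z₃}. -/
noncomputable section
open Matrix Polynomial

/-- The 4×4 permutation matrix (over ℂ) of the transposition exchanging coordinates `i` and `j`. -/
def permMat (i j : Fin 4) : Matrix (Fin 4) (Fin 4) ℂ :=
  Matrix.of fun k l => if l = Equiv.swap i j k then 1 else 0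

/-- `P₁ = P(1,2)`. -/
def P1 : Matrix (Fin 4) (Fin 4) ℂ := permMat 0 1
/-- `P₂ = P(1,3)`. -/
def P2 : Matrix (Fin 4) (Fin 4) ℂ := permMat 0 2
/-- `P₃ = P(1,4)`. -/
def P3 : Matrix (Fin 4) (Fin 4) ℂ := permMat 0 3

/-- `A(z) = Σ_{k=1}^{3} P_k/(z − z_k)`. -/
def Amat (z₁ z₂ z₃ z : ℂ) : Matrix (Fin 4) (Fin 4) ℂ :=
  (z - z₁)⁻¹ • P1 + (z - z₂)⁻¹ • P2 + (z - z₃)⁻¹ • P3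

/-- `α₁ = (z₃ − z₂)⁻¹`. -/
def al1 (z₁ z₂ z₃ : ℂ) : ℂ := (z₃ - z₂)⁻¹
/-- `α₂ = (z₁ − z₃)⁻¹`. -/
def al2 (z₁ z₂ z₃ : ℂ) : ℂ := (z₁ - z₃)⁻¹
/-- `α₃ = (z₂ − z₁)⁻¹`. -/
def al3 (z₁ z₂ z₃ : ℂ) : ℂ := (z₂ - z₁)⁻¹
/-- `a = −α₁/α₃`. -/
def aY4 (z₁ z₂ z₃ : ℂ) : ℂ := -(al1 z₁ z₂ z₃) / al3 z₁ z₂ z₃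
/-- `c = α₁²/(α₂α₃)`. -/
def cY4 (z₁ z₂ z₃ : ℂ) : ℂ := (al1 z₁ z₂ z₃) ^ 2 / (al2 z₁ z₂ z₃ * al3 z₁ z₂ z₃)
/-- `d = −(α₁²/(α₂α₃³))·(α₁α₂ + α₃²)`. -/
def dY4 (z₁ z₂ z₃ : ℂ) : ℂ :=
  -((al1 z₁ z₂ z₃) ^ 2 / (al2 z₁ z₂ z₃ * (al3 z₁ z₂ z₃) ^ 3))
    * (al1 z₁ z₂ z₃ * al2 z₁ z₂ z₃ + (al3 z₁ z₂ z₃) ^ 2)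
/-- `e = 1 + α₁/α₂`. -/
def eY4 (z₁ z₂ z₃ : ℂ) : ℂ := 1 + al1 z₁ z₂ z₃ / al2 z₁ z₂ z₃
/-- `b = −(α₃/α₂)·d`. -/
def bY4 (z₁ z₂ z₃ : ℂ) : ℂ := -(al3 z₁ z₂ z₃ / al2 z₁ z₂ z₃) * dY4 z₁ z₂ z₃
/-- `ℓ₁ = α₁·(0,0,1,a)ᵀ`. -/
def lv1 (z₁ z₂ z₃ : ℂ) : Fin 4 → ℂ := al1 z₁ z₂ z₃ • ![0, 0, 1, aY4 z₁ z₂ z₃]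
/-- `ℓ₂ = α₂·(0,b,0,c)ᵀ`. -/
def lv2 (z₁ z₂ z₃ : ℂ) : Fin 4 → ℂ := al2 z₁ z₂ z₃ • ![0, bY4 z₁ z₂ z₃, 0, cY4 z₁ z₂ z₃]
/-- `ℓ₃ = α₃·(0,d,e,0)ᵀ`. -/
def lv3 (z₁ z₂ z₃ : ℂ) : Fin 4 → ℂ := al3 z₁ z₂ z₃ • ![0, dY4 z₁ z₂ z₃, eY4 z₁ z₂ z₃, 0]
/-- `Y₄(z) = Σ_{k=1}^{3} ℓ_k/(z − z_k)`. -/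
def Y4 (z₁ z₂ z₃ z : ℂ) : Fin 4 → ℂ :=
  (z - z₁)⁻¹ • lv1 z₁ z₂ z₃ + (z - z₂)⁻¹ • lv2 z₁ z₂ z₃ + (z - z₃)⁻¹ • lv3 z₁ z₂ z₃

lemma perm_mulVec_aux (i j : Fin 4) (v : Fin 4 → ℂ) (k : Fin 4) :
    (permMat i j *ᵥ v) k = v (Equiv.swap i j k) := by
  simp [permMat, Matrix.mulVec, dotProduct]

/-- `Y₄` satisfies `Y₄' = −A·Y₄` on `ℂ ∖ {z₁,z₂,z₃}`. -/
theorem stmt_3 (z₁ z₂ z₃ : ℂ) (h12 : z₁ ≠ z₂) (h13 : z₁ ≠ z₃) (h23 : z₂ ≠ z₃) :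
    ∀ z : ℂ, z ≠ z₁ → z ≠ z₂ → z ≠ z₃ →
      HasDerivAt (fun w => Y4 z₁ z₂ z₃ w) (-(Amat z₁ z₂ z₃ z *ᵥ Y4 z₁ z₂ z₃ z)) z := by
  intro z h1 h2 h3
  have k1 : z - z₁ ≠ 0 := sub_ne_zero.mpr h1
  have k2 : z - z₂ ≠ 0 := sub_ne_zero.mpr h2
  have k3 : z - z₃ ≠ 0 := sub_ne_zero.mpr h3
  have m1 : z₃ - z₂ ≠ 0 := sub_ne_zero.mpr h23.symm
  have m2 : z₁ - z₃ ≠ 0 := sub_ne_zero.mpr h13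
  have m3 : z₂ - z₁ ≠ 0 := sub_ne_zero.mpr h12.symm
  have D : ∀ (t : ℂ), z - t ≠ 0 → ∀ v : Fin 4 → ℂ,
      HasDerivAt (fun w : ℂ => (w - t)⁻¹ • v) ((-1 / (z - t) ^ 2) • v) z := by
    intro t ht v
    exact (((hasDerivAt_id z).sub_const t).inv ht).smul_const v
  have H := ((D z₁ k1 (lv1 z₁ z₂ z₃)).add (D z₂ k2 (lv2 z₁ z₂ z₃))).add
    (D z₃ k3 (lv3 z₁ z₂ z₃))
  refine HasDerivAt.congr_deriv H ?_
  have s1 : Equiv.swap (0 : Fin 4) 1 2 = 2 := by decide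
  have s2 : Equiv.swap (0 : Fin 4) 1 3 = 3 := by decide
  have s3 : Equiv.swap (0 : Fin 4) 2 1 = 1 := by decide
  have s4 : Equiv.swap (0 : Fin 4) 2 3 = 3 := by decide
  have s5 : Equiv.swap (0 : Fin 4) 3 1 = 1 := by decide
  have s6 : Equiv.swap (0 : Fin 4) 3 2 = 2 := by decide
  ext i
  simp only [Amat, P1, P2, P3, Matrix.add_mulVec, Matrix.smul_mulVec, Pi.add_apply, Pi.neg_apply,
    Pi.smul_apply, perm_mulVec_aux, smul_eq_mul]
  fin_cases i <;>
  simp [s1, s2, s3, s4, s5, s6, Y4, lv1, lv2, lv3, aY4, bY4, cY4, dY4, eY4, al1, al2, al3] <;>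
  field_simp <;> ring
end
end

section
/- For every choice of constants c₁, c₂, c₃, c₄ ∈ ℂ, the function Y(z) = c₁Y₁(z) + c₂Y₂(z) + c₃Y₃(z) + c₄Y₄(z) satisfies the KZ system with ρ = −1, i.e. Y'(z) = −A(z)·Y(z) for all z ∈ ℂ ∖ {z₁, z₂, z₃}, and Y is a rational function of z. -/
noncomputable section
open Matrix Polynomial

/-- `L₁ = (1,1,−1,−1)ᵀ`. -/
def L1 : Fin 4 → ℂ := ![1, 1, -1, -1]
/-- `L₂ = α·(1,−1,1,−1)ᵀ` with `α = −(z₃ − z₂)/(z₃ − z₁)`. -/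
def L2 (z₁ z₂ z₃ : ℂ) : Fin 4 → ℂ := (-(z₃ - z₂) / (z₃ - z₁)) • ![1, -1, 1, -1]
/-- `L₃ = β·(1,−1,−1,1)ᵀ` with `β = (z₃ − z₂)/(z₂ − z₁)`. -/
def L3 (z₁ z₂ z₃ : ℂ) : Fin 4 → ℂ := ((z₃ - z₂) / (z₂ - z₁)) • ![1, -1, -1, 1]
/-- `Q₋₁ = −[(z₂ − z₁)(z₃ − z₁)]⁻¹·(3,−1,−1,−1)ᵀ`. -/
def Qm1 (z₁ z₂ z₃ : ℂ) : Fin 4 → ℂ := -(((z₂ - z₁) * (z₃ - z₁))⁻¹ • ![3, -1, -1, -1])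
/-- `Q₀ = [(z₂ − z₁)(z₃ − z₁)]⁻¹·(z₁N₁ + z₂N₂ + z₃N₃)`. -/
def Q0 (z₁ z₂ z₃ : ℂ) : Fin 4 → ℂ :=
  ((z₂ - z₁) * (z₃ - z₁))⁻¹ •
    (z₁ • (![1, 1, -1, -1] : Fin 4 → ℂ) + z₂ • (![1, -1, 1, -1] : Fin 4 → ℂ)
      + z₃ • (![1, -1, -1, 1] : Fin 4 → ℂ))
/-- `Y₁(z) = Σ_{k=1}^{3} L_k/(z − z_k) + Q₋₁·z + Q₀`. -/
def Y1 (z₁ z₂ z₃ z : ℂ) : Fin 4 → ℂ :=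
  (z - z₁)⁻¹ • L1 + (z - z₂)⁻¹ • L2 z₁ z₂ z₃ + (z - z₃)⁻¹ • L3 z₁ z₂ z₃
    + z • Qm1 z₁ z₂ z₃ + Q0 z₁ z₂ z₃

/-- `M_k = β_k·(1,1,1,1)ᵀ`, `β₁ = z₂ − z₃`, `β₂ = z₃ − z₁`, `β₃ = z₁ − z₂`. -/
def M1 (z₁ z₂ z₃ : ℂ) : Fin 4 → ℂ := (z₂ - z₃) • ![1, 1, 1, 1]
def M2 (z₁ z₂ z₃ : ℂ) : Fin 4 → ℂ := (z₃ - z₁) • ![1, 1, 1, 1]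
def M3 (z₁ z₂ z₃ : ℂ) : Fin 4 → ℂ := (z₁ - z₂) • ![1, 1, 1, 1]
/-- `Y₂(z) = Σ_{k=1}^{3} M_k/(z − z_k)`. -/
def Y2 (z₁ z₂ z₃ z : ℂ) : Fin 4 → ℂ :=
  (z - z₁)⁻¹ • M1 z₁ z₂ z₃ + (z - z₂)⁻¹ • M2 z₁ z₂ z₃ + (z - z₃)⁻¹ • M3 z₁ z₂ z₃

/-- `m₁ = β₁·(0,0,1,a)ᵀ` with `a = −β₁/β₃`. -/
def mv1 (z₁ z₂ z₃ : ℂ) : Fin 4 → ℂ := (z₂ - z₃) • ![0, 0, 1, -(z₂ - z₃) / (z₁ - z₂)]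
/-- `m₂ = β₂·(0,b,0,c)ᵀ` with `b = −β₃/β₂`, `c = β₁²/(β₂β₃)`. -/
def mv2 (z₁ z₂ z₃ : ℂ) : Fin 4 → ℂ :=
  (z₃ - z₁) • ![0, -(z₁ - z₂) / (z₃ - z₁), 0, (z₂ - z₃) ^ 2 / ((z₃ - z₁) * (z₁ - z₂))]
/-- `m₃ = β₃·(0,1,a,0)ᵀ`. -/
def mv3 (z₁ z₂ z₃ : ℂ) : Fin 4 → ℂ := (z₁ - z₂) • ![0, 1, -(z₂ - z₃) / (z₁ - z₂), 0]
/-- `Y₃(z) = Σ_{k=1}^{3} m_k/(z − z_k)`. -/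
def Y3 (z₁ z₂ z₃ z : ℂ) : Fin 4 → ℂ :=
  (z - z₁)⁻¹ • mv1 z₁ z₂ z₃ + (z - z₂)⁻¹ • mv2 z₁ z₂ z₃ + (z - z₃)⁻¹ • mv3 z₁ z₂ z₃

theorem Amat_mulVec (z₁ z₂ z₃ z : ℂ) (v : Fin 4 → ℂ) :
    Amat z₁ z₂ z₃ z *ᵥ v =
      ![(z - z₁)⁻¹ * v 1 + (z - z₂)⁻¹ * v 2 + (z - z₃)⁻¹ * v 3,
        (z - z₁)⁻¹ * v 0 + (z - z₂)⁻¹ * v 1 + (z - z₃)⁻¹ * v 1,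
        (z - z₁)⁻¹ * v 2 + (z - z₂)⁻¹ * v 0 + (z - z₃)⁻¹ * v 2,
        (z - z₁)⁻¹ * v 3 + (z - z₂)⁻¹ * v 3 + (z - z₃)⁻¹ * v 0] := by
  have h (a b : Fin 4) : permMat a b *ᵥ v = fun k => v (Equiv.swap a b k) := by
    funext k
    simp [permMat, Matrix.mulVec, dotProduct]
  rw [Amat, Matrix.add_mulVec, Matrix.add_mulVec, Matrix.smul_mulVec, Matrix.smul_mulVec,
    Matrix.smul_mulVec, P1, P2, P3, h, h, h]
  funext k
  fin_cases k <;> simp [Equiv.swap_apply_def]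

theorem gen_deriv (z₁ z₂ z₃ z : ℂ) (h1 : z ≠ z₁) (h2 : z ≠ z₂) (h3 : z ≠ z₃)
    (u v w q r : Fin 4 → ℂ) :
    HasDerivAt (fun x : ℂ => (x - z₁)⁻¹ • u + (x - z₂)⁻¹ • v + (x - z₃)⁻¹ • w + x • q + r)
      ((-1 / (z - z₁) ^ 2) • u + (-1 / (z - z₂) ^ 2) • v + (-1 / (z - z₃) ^ 2) • w + q) z := by
  have k (a : ℂ) (h : z ≠ a) : HasDerivAt (fun x : ℂ => (x - a)⁻¹) (-1 / (z - a) ^ 2) z :=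
    ((hasDerivAt_id z).sub_const a).fun_inv (sub_ne_zero.2 h)
  have e := (((((k z₁ h1).smul_const u).add ((k z₂ h2).smul_const v)).add
    ((k z₃ h3).smul_const w)).add ((hasDerivAt_id z).smul_const q)).add_const r
  rw [one_smul] at e
  exact e

theorem gen_deriv0 (z₁ z₂ z₃ z : ℂ) (h1 : z ≠ z₁) (h2 : z ≠ z₂) (h3 : z ≠ z₃)
    (u v w : Fin 4 → ℂ) :
    HasDerivAt (fun x : ℂ => (x - z₁)⁻¹ • u + (x - z₂)⁻¹ • v + (x - z₃)⁻¹ • w)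
      ((-1 / (z - z₁) ^ 2) • u + (-1 / (z - z₂) ^ 2) • v + (-1 / (z - z₃) ^ 2) • w) z := by
  simpa using gen_deriv z₁ z₂ z₃ z h1 h2 h3 u v w 0 0

theorem Y1_deriv (z₁ z₂ z₃ : ℂ) (h12 : z₁ ≠ z₂) (h13 : z₁ ≠ z₃) (h23 : z₂ ≠ z₃)
    (z : ℂ) (h1 : z ≠ z₁) (h2 : z ≠ z₂) (h3 : z ≠ z₃) :
    HasDerivAt (Y1 z₁ z₂ z₃) (-(Amat z₁ z₂ z₃ z *ᵥ Y1 z₁ z₂ z₃ z)) z := by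
  have a1 : z - z₁ ≠ 0 := sub_ne_zero.2 h1
  have a2 : z - z₂ ≠ 0 := sub_ne_zero.2 h2
  have a3 : z - z₃ ≠ 0 := sub_ne_zero.2 h3
  have b1 : z₂ - z₁ ≠ 0 := sub_ne_zero.2 h12.symm
  have b2 : z₃ - z₁ ≠ 0 := sub_ne_zero.2 h13.symm
  have b3 : z₃ - z₂ ≠ 0 := sub_ne_zero.2 h23.symm
  have b1' : z₁ - z₂ ≠ 0 := sub_ne_zero.2 h12
  have b2' : z₁ - z₃ ≠ 0 := sub_ne_zero.2 h13
  have b3' : z₂ - z₃ ≠ 0 := sub_ne_zero.2 h23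
  have e : HasDerivAt (Y1 z₁ z₂ z₃) _ z := gen_deriv z₁ z₂ z₃ z h1 h2 h3
    L1 (L2 z₁ z₂ z₃) (L3 z₁ z₂ z₃) (Qm1 z₁ z₂ z₃) (Q0 z₁ z₂ z₃)
  refine e.congr_deriv ?_
  rw [Amat_mulVec]
  funext i
  fin_cases i <;> simp [Y1, L1, L2, L3, Qm1, Q0] <;> field_simp <;> ring

theorem Y2_deriv (z₁ z₂ z₃ : ℂ) (h12 : z₁ ≠ z₂) (h13 : z₁ ≠ z₃) (h23 : z₂ ≠ z₃)
    (z : ℂ) (h1 : z ≠ z₁) (h2 : z ≠ z₂) (h3 : z ≠ z₃) :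
    HasDerivAt (Y2 z₁ z₂ z₃) (-(Amat z₁ z₂ z₃ z *ᵥ Y2 z₁ z₂ z₃ z)) z := by
  have a1 : z - z₁ ≠ 0 := sub_ne_zero.2 h1
  have a2 : z - z₂ ≠ 0 := sub_ne_zero.2 h2
  have a3 : z - z₃ ≠ 0 := sub_ne_zero.2 h3
  have b1 : z₂ - z₁ ≠ 0 := sub_ne_zero.2 h12.symm
  have b2 : z₃ - z₁ ≠ 0 := sub_ne_zero.2 h13.symm
  have b3 : z₃ - z₂ ≠ 0 := sub_ne_zero.2 h23.symm
  have b1' : z₁ - z₂ ≠ 0 := sub_ne_zero.2 h12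
  have b2' : z₁ - z₃ ≠ 0 := sub_ne_zero.2 h13
  have b3' : z₂ - z₃ ≠ 0 := sub_ne_zero.2 h23
  have e : HasDerivAt (Y2 z₁ z₂ z₃) _ z := gen_deriv0 z₁ z₂ z₃ z h1 h2 h3
    (M1 z₁ z₂ z₃) (M2 z₁ z₂ z₃) (M3 z₁ z₂ z₃)
  refine e.congr_deriv ?_
  rw [Amat_mulVec]
  funext i
  fin_cases i <;> simp [Y2, M1, M2, M3] <;> field_simp <;> ring

theorem Y3_deriv (z₁ z₂ z₃ : ℂ) (h12 : z₁ ≠ z₂) (h13 : z₁ ≠ z₃) (h23 : z₂ ≠ z₃)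
    (z : ℂ) (h1 : z ≠ z₁) (h2 : z ≠ z₂) (h3 : z ≠ z₃) :
    HasDerivAt (Y3 z₁ z₂ z₃) (-(Amat z₁ z₂ z₃ z *ᵥ Y3 z₁ z₂ z₃ z)) z := by
  have a1 : z - z₁ ≠ 0 := sub_ne_zero.2 h1
  have a2 : z - z₂ ≠ 0 := sub_ne_zero.2 h2
  have a3 : z - z₃ ≠ 0 := sub_ne_zero.2 h3
  have b1 : z₂ - z₁ ≠ 0 := sub_ne_zero.2 h12.symm
  have b2 : z₃ - z₁ ≠ 0 := sub_ne_zero.2 h13.symm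
  have b3 : z₃ - z₂ ≠ 0 := sub_ne_zero.2 h23.symm
  have b1' : z₁ - z₂ ≠ 0 := sub_ne_zero.2 h12
  have b2' : z₁ - z₃ ≠ 0 := sub_ne_zero.2 h13
  have b3' : z₂ - z₃ ≠ 0 := sub_ne_zero.2 h23
  have e : HasDerivAt (Y3 z₁ z₂ z₃) _ z := gen_deriv0 z₁ z₂ z₃ z h1 h2 h3
    (mv1 z₁ z₂ z₃) (mv2 z₁ z₂ z₃) (mv3 z₁ z₂ z₃)
  refine e.congr_deriv ?_
  rw [Amat_mulVec]
  funext i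
  fin_cases i <;> simp [Y3, mv1, mv2, mv3] <;> field_simp <;> ring

theorem Y4_deriv (z₁ z₂ z₃ : ℂ) (h12 : z₁ ≠ z₂) (h13 : z₁ ≠ z₃) (h23 : z₂ ≠ z₃)
    (z : ℂ) (h1 : z ≠ z₁) (h2 : z ≠ z₂) (h3 : z ≠ z₃) :
    HasDerivAt (Y4 z₁ z₂ z₃) (-(Amat z₁ z₂ z₃ z *ᵥ Y4 z₁ z₂ z₃ z)) z := by
  have a1 : z - z₁ ≠ 0 := sub_ne_zero.2 h1
  have a2 : z - z₂ ≠ 0 := sub_ne_zero.2 h2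
  have a3 : z - z₃ ≠ 0 := sub_ne_zero.2 h3
  have b1 : z₂ - z₁ ≠ 0 := sub_ne_zero.2 h12.symm
  have b2 : z₃ - z₁ ≠ 0 := sub_ne_zero.2 h13.symm
  have b3 : z₃ - z₂ ≠ 0 := sub_ne_zero.2 h23.symm
  have b1' : z₁ - z₂ ≠ 0 := sub_ne_zero.2 h12
  have b2' : z₁ - z₃ ≠ 0 := sub_ne_zero.2 h13
  have b3' : z₂ - z₃ ≠ 0 := sub_ne_zero.2 h23
  have e : HasDerivAt (Y4 z₁ z₂ z₃) _ z := gen_deriv0 z₁ z₂ z₃ z h1 h2 h3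
    (lv1 z₁ z₂ z₃) (lv2 z₁ z₂ z₃) (lv3 z₁ z₂ z₃)
  refine e.congr_deriv ?_
  rw [Amat_mulVec]
  funext i
  fin_cases i <;> simp [Y4, lv1, lv2, lv3, aY4, bY4, cY4, dY4, eY4, al1, al2, al3] <;> field_simp <;> ring

/-- for every `c₁, c₂, c₃, c₄ ∈ ℂ`, the function
`Y = c₁Y₁ + c₂Y₂ + c₃Y₃ + c₄Y₄` satisfies `Y' = −A·Y` on `ℂ ∖ {z₁,z₂,z₃}`, and each of its
components is a rational function of `z`. -/
theorem stmt_15 (z₁ z₂ z₃ : ℂ) (h12 : z₁ ≠ z₂) (h13 : z₁ ≠ z₃) (h23 : z₂ ≠ z₃)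
    (c₁ c₂ c₃ c₄ : ℂ) :
    (∀ z : ℂ, z ≠ z₁ → z ≠ z₂ → z ≠ z₃ →
      HasDerivAt
        (fun w => c₁ • Y1 z₁ z₂ z₃ w + c₂ • Y2 z₁ z₂ z₃ w + c₃ • Y3 z₁ z₂ z₃ w
          + c₄ • Y4 z₁ z₂ z₃ w)
        (-(Amat z₁ z₂ z₃ z *ᵥ
          (c₁ • Y1 z₁ z₂ z₃ z + c₂ • Y2 z₁ z₂ z₃ z + c₃ • Y3 z₁ z₂ z₃ z
            + c₄ • Y4 z₁ z₂ z₃ z))) z) ∧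
    (∀ i : Fin 4, ∃ p q : Polynomial ℂ, q ≠ 0 ∧
      ∀ z : ℂ, z ≠ z₁ → z ≠ z₂ → z ≠ z₃ →
        q.eval z ≠ 0 ∧
          (c₁ • Y1 z₁ z₂ z₃ z + c₂ • Y2 z₁ z₂ z₃ z + c₃ • Y3 z₁ z₂ z₃ z
            + c₄ • Y4 z₁ z₂ z₃ z) i = p.eval z / q.eval z) := by
  refine ⟨fun z h1 h2 h3 => ?_, fun i => ?_⟩
  · have e := ((((Y1_deriv z₁ z₂ z₃ h12 h13 h23 z h1 h2 h3).const_smul c₁).add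
      ((Y2_deriv z₁ z₂ z₃ h12 h13 h23 z h1 h2 h3).const_smul c₂)).add
      ((Y3_deriv z₁ z₂ z₃ h12 h13 h23 z h1 h2 h3).const_smul c₃)).add
      ((Y4_deriv z₁ z₂ z₃ h12 h13 h23 z h1 h2 h3).const_smul c₄)
    refine e.congr_deriv ?_
    simp only [Matrix.mulVec_add, Matrix.mulVec_smul, neg_add, smul_neg]
  · obtain ⟨u, hu⟩ : ∃ u, u = (c₁ • L1 + c₂ • M1 z₁ z₂ z₃ + c₃ • mv1 z₁ z₂ z₃
      + c₄ • lv1 z₁ z₂ z₃) i := ⟨_, rfl⟩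
    obtain ⟨v, hv⟩ : ∃ v, v = (c₁ • L2 z₁ z₂ z₃ + c₂ • M2 z₁ z₂ z₃ + c₃ • mv2 z₁ z₂ z₃
      + c₄ • lv2 z₁ z₂ z₃) i := ⟨_, rfl⟩
    obtain ⟨w, hw⟩ : ∃ w, w = (c₁ • L3 z₁ z₂ z₃ + c₂ • M3 z₁ z₂ z₃ + c₃ • mv3 z₁ z₂ z₃
      + c₄ • lv3 z₁ z₂ z₃) i := ⟨_, rfl⟩
    refine ⟨C u * ((X - C z₂) * (X - C z₃)) + C v * ((X - C z₁) * (X - C z₃))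
      + C w * ((X - C z₁) * (X - C z₂))
      + (C (c₁ * Qm1 z₁ z₂ z₃ i) * X + C (c₁ * Q0 z₁ z₂ z₃ i))
        * ((X - C z₁) * (X - C z₂) * (X - C z₃)),
      (X - C z₁) * (X - C z₂) * (X - C z₃),
      mul_ne_zero (mul_ne_zero (X_sub_C_ne_zero _) (X_sub_C_ne_zero _)) (X_sub_C_ne_zero _),
      fun z h1 h2 h3 => ?_⟩
    have a1 : z - z₁ ≠ 0 := sub_ne_zero.2 h1
    have a2 : z - z₂ ≠ 0 := sub_ne_zero.2 h2
    have a3 : z - z₃ ≠ 0 := sub_ne_zero.2 h3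
    refine ⟨by simp [a1, a2, a3], ?_⟩
    have key : (c₁ • Y1 z₁ z₂ z₃ z + c₂ • Y2 z₁ z₂ z₃ z + c₃ • Y3 z₁ z₂ z₃ z
        + c₄ • Y4 z₁ z₂ z₃ z) i = (z - z₁)⁻¹ * u + (z - z₂)⁻¹ * v + (z - z₃)⁻¹ * w
          + z * (c₁ * Qm1 z₁ z₂ z₃ i) + c₁ * Q0 z₁ z₂ z₃ i := by
      rw [hu, hv, hw]
      simp only [Y1, Y2, Y3, Y4, Pi.add_apply, Pi.smul_apply, smul_eq_mul]
      ring
    rw [key]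
    simp only [eval_add, eval_mul, eval_sub, eval_X, eval_C]
    field_simp
    ring
end
end
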